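/- arXiv:1803.00001 — 4 statements merged into one kernel-verified Lean document; each statement's English description precedes it below -/
import Mathlib

section
/- Let X be a nonempty set, let k̂ : X × X → ℝ be a symmetric function, fix x₀ ∈ X, and define K : X × X → ℝ by K(x,y) = k̂(x,y) − k̂(x,x₀) − k̂(x₀,y) + k̂(x₀,x₀). Then K is positive definite if and only if k̂ is conditionally positive definite. -/
open Finset

/-- Expansion of the quadratic form of the kernel `K` centred at `x₀` in terms of `k`. -/
theorem sum_mul_centred_kernel {X : Type*} (k : X → X → ℝ) (x₀ : X) (K : X → X → ℝ)
    (hK : ∀ x y : X, K x y = k x y - k x x₀ - k x₀ y + k x₀ x₀)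
    {n : ℕ} (x : Fin n → X) (c : Fin n → ℝ) :
    ∑ i, ∑ j, c i * c j * K (x i) (x j) =
      ∑ i, ∑ j, c i * c j * k (x i) (x j) - (∑ i, c i * k (x i) x₀) * ∑ j, c j
        - (∑ i, c i) * ∑ j, c j * k x₀ (x j) + (∑ i, c i) * (∑ j, c j) * k x₀ x₀ := by
  rw [Finset.sum_mul_sum, Finset.sum_mul_sum, Finset.sum_mul_sum]
  simp only [Finset.sum_mul, ← Finset.sum_sub_distrib, ← Finset.sum_add_distrib, hK]
  refine Finset.sum_congr rfl fun i _ => Finset.sum_congr rfl fun j _ => ?_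
  ring

theorem abdiv_pd_iff_cpd {X : Type*} [Nonempty X] (khat : X → X → ℝ)
    (hsym : ∀ x y : X, khat x y = khat y x) (x₀ : X)
    (K : X → X → ℝ)
    (hK : ∀ x y : X, K x y = khat x y - khat x x₀ - khat x₀ y + khat x₀ x₀) :
    (∀ (n : ℕ) (x : Fin n → X) (c : Fin n → ℝ),
        0 ≤ ∑ i, ∑ j, c i * c j * K (x i) (x j)) ↔
    (∀ (n : ℕ) (x : Fin n → X) (c : Fin n → ℝ), (∑ i, c i) = 0 →
        0 ≤ ∑ i, ∑ j, c i * c j * khat (x i) (x j)) := by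
  constructor
  · intro h n x c hc
    simpa [sum_mul_centred_kernel khat x₀ K hK, hc] using h n x c
  · intro h n x c
    have h' := h (n + 1) (Fin.cons x₀ x) (Fin.cons (-∑ i, c i) c) (by simp [Fin.sum_univ_succ])
    simp only [Fin.sum_univ_succ, Fin.cons_zero, Fin.cons_succ, Finset.sum_add_distrib] at h'
    have hrow : ∑ j, -(∑ i, c i) * c j * khat x₀ (x j) =
        -(∑ i, c i) * ∑ j, c j * khat x₀ (x j) := by
      simp only [Finset.mul_sum, mul_assoc]
    have hcol : ∑ i, c i * -(∑ j, c j) * khat (x i) x₀ =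
        -((∑ i, c i * khat (x i) x₀) * ∑ j, c j) := by
      rw [← mul_neg, Finset.sum_mul]
      exact Finset.sum_congr rfl fun i _ => by ring
    rw [hrow, hcol] at h'
    rw [sum_mul_centred_kernel khat x₀ K hK]
    linarith
end

section
/- Let X be a nonempty set and d² : X × X → ℝ a nonnegative symmetric function with d²(x,x) = 0 such that −d² is conditionally positive definite. Then for every σ > 0 the Gaussian-transformed kernel K_σ(x,y) = exp(−d²(x,y)/(2σ²)) is positive definite: for every n ∈ ℕ, all x₁,…,xₙ ∈ X and all reals c₁,…,cₙ, ∑_{i,j=1}^n c_i c_j exp(−d²(x_i,x_j)/(2σ²)) ≥ 0. -/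
open Finset

/-- The entrywise exponential of a positive semidefinite real matrix is positive semidefinite. -/
theorem Matrix.PosSemidef.map_exp {ι : Type*} [Fintype ι] {A : Matrix ι ι ℝ}
    (hA : A.PosSemidef) : (A.map Real.exp).PosSemidef := by
  have hpow (k : ℕ) : (A.map (· ^ k)).PosSemidef := by
    induction k with
    | zero =>
      convert Matrix.posSemidef_vecMulVec_self_star (fun _ : ι => (1 : ℝ)) using 1
      ext i j
      simp [Matrix.vecMulVec_apply]
    | succ k ih =>
      have h : A.map (· ^ (k + 1)) = (A.map (· ^ k)).hadamard A := by
        ext i j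
        simp [pow_succ]
      exact h ▸ ih.hadamard hA
  refine .of_dotProduct_mulVec_nonneg (hA.isHermitian.map _ fun _ => rfl) fun c => ?_
  have hsum : HasSum (fun k : ℕ => ((k.factorial : ℝ)⁻¹) * (star c ⬝ᵥ (A.map (· ^ k)).mulVec c))
      (star c ⬝ᵥ (A.map Real.exp).mulVec c) := by
    simp only [dotProduct, Matrix.mulVec, Finset.mul_sum, Matrix.map_apply]
    refine hasSum_sum fun i _ => hasSum_sum fun j _ => ?_
    have h := NormedSpace.expSeries_div_hasSum_exp (A i j)
    rw [← Real.exp_eq_exp_ℝ] at h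
    rw [← mul_assoc]
    refine ((h.mul_left (star c i)).mul_right (c j)).congr_fun fun k => ?_
    ring
  exact hsum.nonneg fun k => mul_nonneg (by positivity) ((hpow k).dotProduct_mulVec_nonneg c)

theorem Matrix.posSemidef_of_conditionally_nonneg {X : Type*} (d : X → X → ℝ)
    (hsym : ∀ x y : X, d x y = d y x) (hdiag : ∀ x : X, d x x = 0)
    (hcpd : ∀ (n : ℕ) (x : Fin n → X) (c : Fin n → ℝ), (∑ i, c i) = 0 →
        0 ≤ ∑ i, ∑ j, c i * c j * (-(d (x i) (x j))))
    (z : X) {n : ℕ} (x : Fin n → X) :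
    (Matrix.of fun i j => d (x i) z + d (x j) z - d (x i) (x j)).PosSemidef := by
  refine .of_dotProduct_mulVec_nonneg ?_ fun c => ?_
  · ext i j
    simp [hsym (x i) (x j), add_comm]
  · have h := hcpd (n + 1) (Fin.cons z x) (Fin.cons (-∑ i, c i) c) (by simp [Fin.sum_univ_succ])
    refine h.trans_eq ?_
    simp only [Fin.sum_univ_succ, Fin.cons_zero, Fin.cons_succ, hdiag, hsym z, dotProduct,
      Matrix.mulVec, Matrix.of_apply, star_trivial, Finset.mul_sum, Finset.sum_add_distrib]
    have h₁ : ∑ i, -(∑ k, c k) * c i * -d (x i) z = ∑ i, ∑ j, c i * (d (x i) z * c j) := by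
      simp only [← Finset.mul_sum]
      refine Finset.sum_congr rfl fun i _ => by ring
    have h₂ : ∑ i, c i * -(∑ k, c k) * -d (x i) z = ∑ i, ∑ j, c i * (d (x j) z * c j) := by
      rw [Finset.sum_comm]
      simp only [← Finset.sum_mul]
      refine Finset.sum_congr rfl fun i _ => by ring
    rw [h₁, h₂]
    simp only [neg_zero, mul_zero, zero_add, ← Finset.sum_add_distrib]
    refine Finset.sum_congr rfl fun i _ => Finset.sum_congr rfl fun j _ => by ring

theorem gaussian_transform_pd_of_cpd {X : Type*} [Nonempty X] (d2 : X → X → ℝ)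
    (hnonneg : ∀ x y : X, 0 ≤ d2 x y) (hsym : ∀ x y : X, d2 x y = d2 y x)
    (hdiag : ∀ x : X, d2 x x = 0)
    (hcpd : ∀ (n : ℕ) (x : Fin n → X) (c : Fin n → ℝ), (∑ i, c i) = 0 →
        0 ≤ ∑ i, ∑ j, c i * c j * (-(d2 (x i) (x j)))) :
    ∀ σ : ℝ, 0 < σ → ∀ (n : ℕ) (x : Fin n → X) (c : Fin n → ℝ),
        0 ≤ ∑ i, ∑ j, c i * c j * Real.exp (-(d2 (x i) (x j)) / (2 * σ ^ 2)) := by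
  intro σ _ n x c
  obtain ⟨z⟩ := ‹Nonempty X›
  have hB := ((Matrix.posSemidef_of_conditionally_nonneg d2 hsym hdiag hcpd z x).smul
    (show (0 : ℝ) ≤ (2 * σ ^ 2)⁻¹ by positivity)).map_exp
  refine (hB.dotProduct_mulVec_nonneg
    (fun i => c i * Real.exp (-(d2 (x i) z) / (2 * σ ^ 2)))).trans_eq ?_
  simp only [dotProduct, Matrix.mulVec, Finset.mul_sum, Matrix.map_apply, Matrix.smul_apply,
    Matrix.of_apply, star_trivial, smul_eq_mul]
  refine Finset.sum_congr rfl fun i _ => Finset.sum_congr rfl fun j _ => ?_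
  have hexp : Real.exp (-(d2 (x i) (x j)) / (2 * σ ^ 2)) =
      Real.exp (-(d2 (x i) z) / (2 * σ ^ 2)) * Real.exp (-(d2 (x j) z) / (2 * σ ^ 2)) *
        Real.exp ((2 * σ ^ 2)⁻¹ * (d2 (x i) z + d2 (x j) z - d2 (x i) (x j))) := by
    rw [← Real.exp_add, ← Real.exp_add]
    ring_nf
  rw [hexp]
  ring
end

section
/- Let X be a measurable space, let P and Q be finite measures on X, and let μ, ν be σ-finite measures on X with P ≪ μ, Q ≪ μ, μ ≪ ν. Let d² : [0,∞) × [0,∞) → [0,∞) be a measurable function that is 1-homogeneous, i.e. d²(c·x, c·y) = c·d²(x,y) for all c,x,y ≥ 0. Then ∫_X d²((dP/dμ)(x), (dQ/dμ)(x)) dμ(x) = ∫_X d²((dP/dν)(x), (dQ/dν)(x)) dν(x), where dP/dμ etc. denote Radon–Nikodym derivatives; i.e. the induced divergence D²(P,Q) = ∫ d²(p,q) dμ is independent of the choice of dominating measure. -/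
open MeasureTheory ENNReal NNReal

theorem divergence_independent_of_dominating_measure
    {X : Type*} [MeasurableSpace X] (P Q μ ν : Measure X)
    [IsFiniteMeasure P] [IsFiniteMeasure Q] [SigmaFinite μ] [SigmaFinite ν]
    (hPμ : P ≪ μ) (hQμ : Q ≪ μ) (hμν : μ ≪ ν)
    (d2 : ℝ≥0∞ → ℝ≥0∞ → ℝ≥0∞)
    (hmeas : Measurable fun p : ℝ≥0∞ × ℝ≥0∞ => d2 p.1 p.2)
    (hhom : ∀ (c : ℝ≥0) (x y : ℝ≥0∞), d2 (c * x) (c * y) = c * d2 x y) :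
    ∫⁻ x, d2 (P.rnDeriv μ x) (Q.rnDeriv μ x) ∂μ =
      ∫⁻ x, d2 (P.rnDeriv ν x) (Q.rnDeriv ν x) ∂ν := by
  have hd : Measurable fun x => d2 (P.rnDeriv μ x) (Q.rnDeriv μ x) :=
    hmeas.comp ((P.measurable_rnDeriv μ).prodMk (Q.measurable_rnDeriv μ))
  rw [← lintegral_rnDeriv_mul hμν hd.aemeasurable]
  refine lintegral_congr_ae ?_
  filter_upwards [Measure.rnDeriv_mul_rnDeriv (κ := ν) hPμ,
    Measure.rnDeriv_mul_rnDeriv (κ := ν) hQμ, μ.rnDeriv_lt_top ν] with x hP hQ hlt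
  have h := hhom (μ.rnDeriv ν x).toNNReal (P.rnDeriv μ x) (Q.rnDeriv μ x)
  rw [coe_toNNReal hlt.ne] at h
  rw [← h, ← hP, ← hQ, Pi.mul_apply, Pi.mul_apply, mul_comm (P.rnDeriv μ x),
    mul_comm (Q.rnDeriv μ x)]
end

section
/- Let (X,μ) be a measure space, let α, β ∈ ℝ with αβ > 0, and let p, q : X → (0,∞) be measurable functions such that the function x ↦ (1/(αβ))(p(x)^α − q(x)^α)(p(x)^β − q(x)^β) is μ-integrable. Then D_{ABS}^{(α,β)}(p,q) = (1/(αβ)) ∫_X (p(x)^α − q(x)^α)(p(x)^β − q(x)^β) dμ(x) satisfies D_{ABS}^{(α,β)}(p,q) ≥ 0, and D_{ABS}^{(α,β)}(p,q) = 0 if and only if p = q μ-almost everywhere (strict positivity of the ABS-divergence). -/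
open MeasureTheory

/-- Real powers with exponents of the same sign are strictly co-monotone on positive reals. -/
theorem Real.mul_rpow_sub_rpow_pos {a b α β : ℝ} (h : 0 < α * β) (ha : 0 < a) (hb : 0 < b)
    (hab : a ≠ b) : 0 < (a ^ α - b ^ α) * (a ^ β - b ^ β) := by
  wlog hlt : a < b generalizing a b
  · have := this hb ha hab.symm (hab.lt_or_gt.resolve_left hlt)
    linarith
  rcases pos_and_pos_or_neg_and_neg_of_mul_pos h with ⟨hα, hβ⟩ | ⟨hα, hβ⟩
  · exact mul_pos_of_neg_of_neg (sub_neg.2 (Real.rpow_lt_rpow ha.le hlt hα))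
      (sub_neg.2 (Real.rpow_lt_rpow ha.le hlt hβ))
  · exact mul_pos (sub_pos.2 (Real.rpow_lt_rpow_of_neg ha hlt hα))
      (sub_pos.2 (Real.rpow_lt_rpow_of_neg ha hlt hβ))

theorem abs_divergence_strict_positivity {X : Type*} [MeasurableSpace X] (μ : Measure X)
    (α β : ℝ) (h : 0 < α * β)
    (p q : X → ℝ) (hp : Measurable p) (hq : Measurable q)
    (hp0 : ∀ x, 0 < p x) (hq0 : ∀ x, 0 < q x)
    (hint : Integrable
      (fun x => (1 / (α * β)) * ((p x ^ α - q x ^ α) * (p x ^ β - q x ^ β))) μ) :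
    0 ≤ ∫ x, (1 / (α * β)) * ((p x ^ α - q x ^ α) * (p x ^ β - q x ^ β)) ∂μ ∧
    (∫ x, (1 / (α * β)) * ((p x ^ α - q x ^ α) * (p x ^ β - q x ^ β)) ∂μ = 0 ↔
      p =ᵐ[μ] q) := by
  have hpos : ∀ x, p x ≠ q x →
      0 < (1 / (α * β)) * ((p x ^ α - q x ^ α) * (p x ^ β - q x ^ β)) := fun x hx =>
    mul_pos (one_div_pos.2 h) (Real.mul_rpow_sub_rpow_pos h (hp0 x) (hq0 x) hx)
  have hzero : ∀ x, p x = q x →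
      (1 / (α * β)) * ((p x ^ α - q x ^ α) * (p x ^ β - q x ^ β)) = 0 := fun x hx => by
    simp [hx]
  have hnonneg : ∀ x, 0 ≤ (1 / (α * β)) * ((p x ^ α - q x ^ α) * (p x ^ β - q x ^ β)) := fun x =>
    (eq_or_ne (p x) (q x)).elim (fun hx => (hzero x hx).ge) fun hx => (hpos x hx).le
  refine ⟨integral_nonneg hnonneg, ?_⟩
  rw [integral_eq_zero_iff_of_nonneg hnonneg hint]
  refine Filter.eventually_congr (Filter.Eventually.of_forall fun x => ?_)
  exact ⟨fun hx => by_contra fun hne => (hpos x hne).ne' hx, hzero x⟩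
end
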